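/- The second moment of r·s₃′(r) satisfies ∫₀^∞ r²·(r·s₃′(r)) dr = 8/√π. -/

import Mathlib

open MeasureTheory Real Filter

/-- The error function `erf(r) = (2/√π) ∫₀^r e^{−t²} dt`. -/
noncomputable def erf (r : ℝ) : ℝ :=
  (2 / Real.sqrt Real.pi) * ∫ t in (0:ℝ)..r, Real.exp (-t ^ 2)

/-- The smoothing function `s₃(r) = erf(r) − 2r((2/3)r² + 1)e^{−r²}/√π`. -/
noncomputable def s3 (r : ℝ) : ℝ :=
  erf r - 2 * r * ((2 / 3) * r ^ 2 + 1) * Real.exp (-r ^ 2) / Real.sqrt Real.pi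

theorem hasDerivAt_erf (r : ℝ) :
    HasDerivAt erf (2 / Real.sqrt Real.pi * Real.exp (-r ^ 2)) r := by
  have hc : Continuous fun t : ℝ => Real.exp (-t ^ 2) := by fun_prop
  exact (intervalIntegral.integral_hasDerivAt_right (hc.intervalIntegrable 0 r)
    (hc.stronglyMeasurableAtFilter _ _) hc.continuousAt).const_mul _

theorem hasDerivAt_s3 (r : ℝ) :
    HasDerivAt s3 (8 / (3 * Real.sqrt Real.pi) * (r ^ 4 * Real.exp (-r ^ 2))) r := by
  have hpoly : HasDerivAt (fun x : ℝ => 2 * x * ((2 / 3) * x ^ 2 + 1)) (4 * r ^ 2 + 2) r := by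
    have h := ((hasDerivAt_id' r).const_mul 2).mul
      (((hasDerivAt_pow 2 r).const_mul (2 / 3 : ℝ)).add_const 1)
    refine h.congr_deriv ?_
    norm_num
    ring
  have hexp : HasDerivAt (fun x : ℝ => Real.exp (-x ^ 2)) (Real.exp (-r ^ 2) * (-(2 * r))) r := by
    simpa using (hasDerivAt_pow 2 r).fun_neg.exp
  refine ((hasDerivAt_erf r).sub ((hpoly.mul hexp).div_const (Real.sqrt Real.pi))).congr_deriv ?_
  have hpi : Real.sqrt Real.pi ≠ 0 := (Real.sqrt_pos.2 Real.pi_pos).ne'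
  field_simp
  ring

theorem integral_pow_seven_mul_exp_neg_sq :
    ∫ r in Set.Ioi (0:ℝ), r ^ 7 * Real.exp (-r ^ 2) = 3 := by
  have h := integral_rpow_mul_exp_neg_rpow (p := 2) (q := 7) (by norm_num) (by norm_num)
  have hG : Real.Gamma ((7 + 1) / 2) = 6 := by
    have h4 := Real.Gamma_nat_eq_factorial 3
    norm_num [Nat.factorial] at h4 ⊢
  rw [hG] at h
  norm_num at h
  exact_mod_cast h

/-- `∫₀^∞ r² (r s₃′(r)) dr = 8/√π`. -/
theorem second_moment_r_deriv_s3 :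
    ∫ r in Set.Ioi (0:ℝ), r ^ 2 * (r * deriv s3 r) = 8 / Real.sqrt Real.pi := by
  have h : ∀ r : ℝ, r ^ 2 * (r * deriv s3 r) =
      8 / (3 * Real.sqrt Real.pi) * (r ^ 7 * Real.exp (-r ^ 2)) := fun r => by
    rw [(hasDerivAt_s3 r).deriv]
    ring
  simp_rw [h]
  rw [integral_const_mul, integral_pow_seven_mul_exp_neg_sq]
  field_simp
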